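/- arXiv:1912.04193 — 2 statements merged into one kernel-verified Lean document; each statement's English description precedes it below -/
import Mathlib

section
/- Let α ∈ (0, 2) and λ > 0. Then the function u ↦ e^{-λu} η₁^{(α/2)}(u) is Lebesgue integrable on (0,∞) and ∫₀^∞ e^{-λ u} η₁^{(α/2)}(u) du = e^{-λ^{α/2}}, where η₁^{(α/2)} is defined by its convergent series representation. -/
open Real MeasureTheory

/-- The `n`-th term (`n = 0, 1, 2, ...`, corresponding to the index `n+1` in Zolotarev's
formula 2.4.8) of the series defining the `α/2`-stable density at time 1. -/
noncomputable def etaTerm (α u : ℝ) (n : ℕ) : ℝ :=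
  (-1) ^ n * Real.Gamma (((n:ℝ) + 1) * α / 2 + 1) * Real.sin (π * ((n:ℝ) + 1) * α / 2) /
    (Real.Gamma ((n:ℝ) + 2) * u ^ (1 + ((n:ℝ) + 1) * α / 2))

/-- The density `η₁^{(α/2)}(u)` of the `α/2`-stable subordinator at time 1, defined by its
series representation (Zolotarev, formula 2.4.8). -/
noncomputable def eta (α u : ℝ) : ℝ := (1 / π) * ∑' n : ℕ, etaTerm α u n


lemma sd_intA (b d : ℝ) (hb : 0 < b) (hd : 0 < d) :
    IntegrableOn (fun s : ℝ => Real.exp (-d * s ^ b)) (Set.Ioi 0) := by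
  by_contra h
  have h1 := integral_undef h
  rw [integral_exp_neg_mul_rpow hb hd] at h1
  have h2 : 0 < d ^ (-1 / b) * Real.Gamma (1 / b + 1) := by
    have := Real.Gamma_pos_of_pos (show 0 < 1 / b + 1 by positivity)
    positivity
  exact h2.ne' h1

lemma sd_intB (b v : ℝ) (hb : 0 < b) (hb1 : b < 1) (hv : 0 < v) :
    IntegrableOn (fun s : ℝ => Real.exp (s ^ b) * Real.exp (-v * s)) (Set.Ioi 0) := by
  apply integrable_of_isBigO_exp_neg (b := v / 2) (by positivity)
  · apply ContinuousOn.mul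
    · exact (Real.continuous_exp.comp (Real.continuous_rpow_const hb.le)).continuousOn
    · fun_prop
  · have h1 : Filter.Tendsto (fun x : ℝ => x ^ (-(1 - b))) Filter.atTop (nhds 0) :=
      tendsto_rpow_neg_atTop (by linarith)
    have h2 : ∀ᶠ x : ℝ in Filter.atTop, x ^ (-(1 - b)) < v / 2 :=
      h1.eventually (gt_mem_nhds (by positivity))
    apply Asymptotics.IsBigO.of_bound 1
    filter_upwards [h2, Filter.eventually_gt_atTop 0] with x hx hx0
    rw [← Real.exp_add, Real.norm_of_nonneg (Real.exp_nonneg _),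
      Real.norm_of_nonneg (Real.exp_nonneg _), one_mul, Real.exp_le_exp]
    have : x ^ b = x ^ (-(1 - b)) * x := by
      rw [← Real.rpow_add_one hx0.ne']; congr 1; ring
    rw [this]
    nlinarith

/-- explicit integral along a ray -/
lemma sd_ray (l : ℝ) (hl : 0 < l) (w : ℂ) (hw : ‖w‖ = 1) (hre : w.re < 0) (him : 0 < w.im) :
    IntegrableOn (fun s : ℝ => w * (2 * l / ((l + s * w) * (l - s * w)))) (Set.Ioi 0) ∧
    ∫ s in Set.Ioi (0:ℝ), w * (2 * l / ((l + s * w) * (l - s * w))) = π * Complex.I := by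
  have hsq : w.re ^ 2 + w.im ^ 2 = 1 := by
    have := Complex.sq_norm w
    rw [hw, Complex.normSq_apply] at this; nlinarith
  have hre1 : 0 < 1 + w.re := by nlinarith
  have hp : ∀ s : ℝ, 0 ≤ s → (l + s * w : ℂ) ≠ 0 := by
    intro s hs h
    have h1 := congrArg Complex.im h
    have h2 := congrArg Complex.re h
    simp at h1 h2
    rcases h1 with h1 | h1
    · simp [h1] at h2; linarith
    · linarith
  have hm : ∀ s : ℝ, 0 ≤ s → (l - s * w : ℂ) ≠ 0 := by
    intro s hs h
    have h2 := congrArg Complex.re h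
    simp at h2
    nlinarith
  have hcont : ContinuousOn (fun s : ℝ => w * (2 * l / ((l + s * w) * (l - s * w)))) (Set.Ici 0) := by
    refine continuousOn_const.mul (ContinuousOn.div continuousOn_const (by fun_prop) ?_)
    intro s hs
    exact mul_ne_zero (hp s hs) (hm s hs)
  have hint : IntegrableOn (fun s : ℝ => w * (2 * l / ((l + s * w) * (l - s * w)))) (Set.Ioi 0) := by
    have hI : Integrable (fun s : ℝ => (2 / (l * Real.sqrt (1 + w.re))) * (1 + (s / l) ^ 2)⁻¹) :=
      (integrable_inv_one_add_sq.comp_div hl.ne').const_mul _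
    refine Integrable.mono' hI.integrableOn
      ((hcont.mono Set.Ioi_subset_Ici_self).aestronglyMeasurable measurableSet_Ioi) ?_
    refine (ae_restrict_iff' measurableSet_Ioi).2 (Filter.Eventually.of_forall ?_)
    intro s (hs : 0 < s)
    have e1 : Real.sqrt (1 + w.re) * Real.sqrt (l ^ 2 + s ^ 2) ≤ ‖(l + s * w : ℂ)‖ := by
      rw [← Real.sqrt_mul hre1.le]
      apply Real.sqrt_le_iff.2 ⟨norm_nonneg _, _⟩
      rw [Complex.sq_norm, Complex.normSq_apply]
      simp
      nlinarith [mul_nonneg (neg_nonneg.2 hre.le) (sq_nonneg (l - s))]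
    have e2 : Real.sqrt (l ^ 2 + s ^ 2) ≤ ‖(l - s * w : ℂ)‖ := by
      apply Real.sqrt_le_iff.2 ⟨norm_nonneg _, _⟩
      rw [Complex.sq_norm, Complex.normSq_apply]
      simp
      nlinarith [mul_pos (mul_pos hl hs) (neg_pos.2 hre)]
    have e3 : Real.sqrt (1 + w.re) * (l ^ 2 + s ^ 2) ≤ ‖(l + s * w : ℂ)‖ * ‖(l - s * w : ℂ)‖ := by
      calc _ = (Real.sqrt (1 + w.re) * Real.sqrt (l ^ 2 + s ^ 2)) * Real.sqrt (l ^ 2 + s ^ 2) := by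
            rw [mul_assoc, Real.mul_self_sqrt (by positivity)]
        _ ≤ _ := mul_le_mul e1 e2 (Real.sqrt_nonneg _) (norm_nonneg _)
    have hq : 0 < Real.sqrt (1 + w.re) := Real.sqrt_pos.2 hre1
    rw [norm_mul, hw, one_mul, norm_div, norm_mul, norm_mul]
    simp only [Complex.norm_ofNat, Complex.norm_real, Real.norm_of_nonneg hl.le]
    calc _ ≤ 2 * l / (Real.sqrt (1 + w.re) * (l ^ 2 + s ^ 2)) := by
            gcongr
      _ = _ := by field_simp
  refine ⟨hint, ?_⟩
  have hslit : ∀ s : ℝ, 0 ≤ s → (-Complex.I * ((l + s * w) / (l - s * w))) ∈ Complex.slitPlane := by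
    intro s hs
    have hm' := hm s hs
    have hn := Complex.normSq_pos.2 hm'
    rcases hs.eq_or_lt with rfl | hs
    · right; simp [hl.ne']
    · left
      have : (-Complex.I * ((l + s * w) / (l - s * w))).re =
          2 * l * s * w.im / Complex.normSq (l - s * w) := by
        simp [Complex.div_im]
        field_simp
        ring
      rw [this]
      positivity
  have key := integral_Ioi_of_hasDerivAt_of_tendsto' (a := 0)
    (f := fun s : ℝ => Complex.log (-Complex.I * ((l + s * w) / (l - s * w))))
    (f' := fun s : ℝ => w * (2 * l / ((l + s * w) * (l - s * w)))) (m := Complex.log Complex.I)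
    ?_ hint ?_
  · rw [key]
    simp [hl.ne', Complex.log_I, Complex.log_neg_I]
    ring
  · intro s hs
    have hs : 0 ≤ s := hs
    have d0 : HasDerivAt (fun s : ℝ => (s : ℂ) * w) w s := by
      simpa using (Complex.ofRealCLM.hasDerivAt (x := s)).mul_const w
    have d1 := ((d0.const_add (l:ℂ)).div (d0.const_sub (l:ℂ)) (hm s hs)).const_mul (-Complex.I)
    have d2 := d1.clog_real (hslit s hs)
    refine d2.congr_deriv ?_
    have := hp s hs
    have := hm s hs
    have := Complex.I_ne_zero
    simp only [Pi.div_apply]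
    field_simp
    ring
  · have hc : ContinuousAt Complex.log Complex.I := by
      apply continuousAt_clog; right; simp
    refine hc.tendsto.comp ?_
    have h0 : w ≠ 0 := by rintro rfl; simp at hw
    have t1 : Filter.Tendsto (fun s : ℝ => (l:ℂ) * ((s⁻¹ : ℝ) : ℂ)) Filter.atTop (nhds 0) := by
      have := (Complex.continuous_ofReal.tendsto 0).comp (tendsto_inv_atTop_zero (𝕜 := ℝ))
      simpa using this.const_mul (l:ℂ)
    have t2 : Filter.Tendsto (fun s : ℝ => -Complex.I * (((l:ℂ) * ((s⁻¹ : ℝ) : ℂ) + w) /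
      ((l:ℂ) * ((s⁻¹ : ℝ) : ℂ) - w))) Filter.atTop (nhds (-Complex.I * ((0 + w) / (0 - w)))) :=
      ((t1.add_const w).div (t1.sub_const w) (by simpa using h0)).const_mul _
    have : -Complex.I * ((0 + w) / (0 - w)) = Complex.I := by
      field_simp; simp
    rw [this] at t2
    refine t2.congr' ?_
    filter_upwards [Filter.eventually_gt_atTop 0] with s hs
    have hs' : (s : ℂ) ≠ 0 := by exact_mod_cast hs.ne'
    congr 1
    rw [← mul_div_mul_left _ _ hs']
    congr 1 <;> push_cast <;> field_simp

open Filter Topology in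
lemma sd_rot (F : ℂ → ℂ) (G : ℝ → ℝ) (y0 y1 : ℝ) (hy : y0 ≤ y1)
    (hF : DifferentiableOn ℂ F {w | w.im ∈ Set.Icc y0 y1})
    (l : ℝ) (hl : 0 < l)
    (hG : ∀ x y : ℝ, y ∈ Set.Icc y0 y1 → Real.exp x ≠ l →
      ‖F (x + y * Complex.I)‖ ≤ G (Real.exp x))
    (hG1 : Tendsto G atTop (𝓝 0)) (hG0 : Tendsto G (𝓝[>] 0) (𝓝 0)) :
    Tendsto (fun R : ℝ => (∫ x in (-R)..R, F (x + y0 * Complex.I)) -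
      ∫ x in (-R)..R, F (x + y1 * Complex.I)) atTop (𝓝 0) := by
  have e : ∀ R : ℝ, (∫ x in (-R)..R, F (x + y0 * Complex.I)) -
      (∫ x in (-R)..R, F (x + y1 * Complex.I)) =
      Complex.I * (∫ y in y0..y1, F (((-R : ℝ) : ℂ) + y * Complex.I)) -
      Complex.I * (∫ y in y0..y1, F ((R : ℂ) + y * Complex.I)) := by
    intro R
    have := Complex.integral_boundary_rect_eq_zero_of_differentiableOn F
      (⟨-R, y0⟩ : ℂ) (⟨R, y1⟩ : ℂ) (hF.mono ?_)
    · simp only [smul_eq_mul] at this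
      linear_combination this
    · intro w hw
      have := hw.2
      simpa [Set.uIcc_of_le hy] using this
  simp_rw [e]
  have gen : ∀ (r : ℝ → ℝ), Tendsto (fun R => G (Real.exp (r R))) atTop (𝓝 0) →
      (∀ᶠ R in atTop, Real.exp (r R) ≠ l) →
      Tendsto (fun R : ℝ => Complex.I * ∫ y in y0..y1, F ((r R : ℂ) + y * Complex.I))
        atTop (𝓝 0) := by
    intro r hr hne
    have : Tendsto (fun R => G (Real.exp (r R)) * |y1 - y0|) atTop (𝓝 0) := by
      simpa using hr.mul_const |y1 - y0|
    refine squeeze_zero_norm' ?_ this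
    filter_upwards [hne] with R hR
    rw [norm_mul, Complex.norm_I, one_mul]
    apply intervalIntegral.norm_integral_le_of_norm_le_const
    intro y hy'
    rw [Set.uIoc_of_le hy] at hy'
    exact hG _ _ ⟨hy'.1.le, hy'.2⟩ hR
  have hb : Tendsto (fun R : ℝ => Real.exp (-R)) atTop (𝓝[>] 0) := by
    refine tendsto_nhdsWithin_iff.2 ⟨Real.tendsto_exp_neg_atTop_nhds_zero, ?_⟩
    exact Eventually.of_forall fun x => Real.exp_pos _
  have h1 := gen (fun R => -R) (hG0.comp hb) ?_
  have h2 := gen (fun R => R) (hG1.comp Real.tendsto_exp_atTop) ?_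
  · simpa using h1.sub h2
  · exact (Real.tendsto_exp_atTop.eventually (eventually_gt_atTop l)).mono fun x hx => hx.ne'
  · exact (Real.tendsto_exp_neg_atTop_nhds_zero.eventually (gt_mem_nhds hl)).mono
      fun x hx => hx.ne

open Filter Topology in
lemma sd_cov (g : ℝ → ℂ) (hg : IntegrableOn g (Set.Ioi 0)) :
    Tendsto (fun R : ℝ => ∫ x in (-R)..R, (Real.exp x : ℂ) * g (Real.exp x)) atTop
      (𝓝 (∫ s in Set.Ioi 0, g s)) := by
  have him : Real.exp '' Set.univ = Set.Ioi 0 := by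
    rw [Set.image_univ, Real.range_exp]
  have hd : ∀ x ∈ (Set.univ : Set ℝ), HasDerivWithinAt Real.exp (Real.exp x) Set.univ x :=
    fun x _ => (Real.hasDerivAt_exp x).hasDerivWithinAt
  have hinj := Real.exp_injective.injOn (s := Set.univ)
  rw [← him] at hg ⊢
  rw [integral_image_eq_integral_abs_deriv_smul MeasurableSet.univ hd hinj]
  rw [integrableOn_image_iff_integrableOn_abs_deriv_smul MeasurableSet.univ hd hinj] at hg
  simp only [abs_of_pos (Real.exp_pos _), Complex.real_smul, Measure.restrict_univ,
    integrableOn_univ] at hg ⊢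
  exact intervalIntegral_tendsto_integral hg tendsto_neg_atTop_atBot tendsto_id

lemma sd_eta (α u : ℝ) (hα : α ∈ Set.Ioo (0:ℝ) 2) (hu : 0 < u) :
    eta α u = -(1 / π) * (∫ s in Set.Ioi (0:ℝ),
      Complex.exp (-(((s ^ (α / 2) : ℝ) : ℂ) * Complex.exp (((π * (α / 2) : ℝ) : ℂ) * Complex.I))) *
        ((Real.exp (-u * s) : ℝ) : ℂ)).im := by
  obtain ⟨h0, h2⟩ := hα
  set b := α / 2 with hb
  have hb0 : 0 < b := by positivity
  have hb1 : b < 1 := by linarith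
  set E := Complex.exp (((π * b : ℝ) : ℂ) * Complex.I) with hE
  have hEn : ‖E‖ = 1 := by rw [hE, Complex.norm_exp_ofReal_mul_I]
  have key : HasSum (fun n : ℕ => ∫ s in Set.Ioi (0:ℝ),
      ((-(((s ^ b : ℝ) : ℂ) * E)) ^ n / (n.factorial : ℂ)) * ((Real.exp (-u * s) : ℝ) : ℂ))
      (∫ s in Set.Ioi (0:ℝ), Complex.exp (-(((s ^ b : ℝ) : ℂ) * E)) *
        ((Real.exp (-u * s) : ℝ) : ℂ)) := by
    have hcont : Continuous (fun s : ℝ => s ^ b) := Real.continuous_rpow_const hb0.le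
    apply hasSum_integral_of_dominated_convergence
      (fun n s => ((s ^ b) ^ n / (n.factorial : ℝ)) * Real.exp (-u * s))
    · intro n
      apply Continuous.aestronglyMeasurable
      fun_prop
    · intro n
      refine (ae_restrict_iff' measurableSet_Ioi).2 (Filter.Eventually.of_forall ?_)
      intro s (hs : 0 < s)
      have := Real.rpow_nonneg hs.le b
      rw [norm_mul, norm_div, norm_pow, norm_neg, norm_mul, hEn, Complex.norm_real,
        Complex.norm_real, Real.norm_of_nonneg this, Real.norm_of_nonneg (Real.exp_nonneg _)]
      simp
    · refine Filter.Eventually.of_forall fun s => ?_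
      exact (Real.summable_pow_div_factorial (s ^ b)).mul_right _
    · refine (sd_intB b u hb0 hb1 hu).congr_fun (fun s _ => ?_) measurableSet_Ioi
      simp only
      rw [tsum_mul_right, Real.exp_eq_exp_ℝ, NormedSpace.exp_eq_tsum_div]
    · refine Filter.Eventually.of_forall fun s => ?_
      apply HasSum.mul_right
      rw [Complex.exp_eq_exp_ℂ]
      exact NormedSpace.expSeries_div_hasSum_exp _
  have hterm : ∀ n : ℕ, (∫ s in Set.Ioi (0:ℝ),
      ((-(((s ^ b : ℝ) : ℂ) * E)) ^ n / (n.factorial : ℂ)) * ((Real.exp (-u * s) : ℝ) : ℂ)) =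
      (((-1) ^ n / (n.factorial : ℝ) * ((1 / u) ^ (n * b + 1) * Real.Gamma (n * b + 1)) : ℝ) : ℂ)
        * E ^ n := by
    intro n
    rw [← Real.integral_rpow_mul_exp_neg_mul_Ioi (by positivity : 0 < n * b + 1) hu,
      Complex.ofReal_mul, ← integral_complex_ofReal, mul_right_comm, ← integral_const_mul]
    apply setIntegral_congr_fun measurableSet_Ioi
    intro s (hs : 0 < s)
    simp only
    rw [add_sub_cancel_right, mul_comm (n:ℝ) b, Real.rpow_mul hs.le, Real.rpow_natCast]
    rw [neg_pow, mul_pow, neg_mul]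
    push_cast
    ring
  simp_rw [hterm] at key
  have key2 := (Complex.hasSum_im key)
  have hEpow : ∀ n : ℕ, (E ^ n).im = Real.sin (π * n * b) := by
    intro n
    rw [hE, ← Complex.exp_nat_mul]
    rw [show (n : ℂ) * (((π * b : ℝ) : ℂ) * Complex.I) = ((π * n * b : ℝ) : ℂ) * Complex.I by
      push_cast; ring]
    exact Complex.exp_ofReal_mul_I_im _
  simp_rw [Complex.im_ofReal_mul, hEpow] at key2
  have key3 := (hasSum_nat_add_iff' 1).2 key2
  simp only [Finset.range_one, Finset.sum_singleton, Nat.cast_zero, mul_zero, zero_mul,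
    Real.sin_zero, sub_zero] at key3
  have hsum : HasSum (fun n => etaTerm α u n) (-(∫ s in Set.Ioi (0:ℝ),
      Complex.exp (-(((s ^ b : ℝ) : ℂ) * E)) * ((Real.exp (-u * s) : ℝ) : ℂ)).im) := by
    have hk := key3.neg
    have hfun : (fun n => etaTerm α u n) = fun n : ℕ =>
        -((-1) ^ (n + 1) / ((n + 1).factorial : ℝ) *
          ((1 / u) ^ (((n + 1 : ℕ) : ℝ) * b + 1) * Real.Gamma (((n + 1 : ℕ) : ℝ) * b + 1)) *
          Real.sin (π * ((n + 1 : ℕ) : ℝ) * b)) := by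
      funext n
      have hG : Real.Gamma ((n:ℝ) + 2) = ((n + 1).factorial : ℝ) := by
        rw [← Real.Gamma_nat_eq_factorial]; congr 1; push_cast; ring
      have hq : (1 / u) ^ (((n + 1 : ℕ) : ℝ) * b + 1) =
          (u ^ (1 + ((n:ℝ) + 1) * α / 2))⁻¹ := by
        rw [one_div, Real.inv_rpow hu.le]
        congr 2
        rw [hb]; push_cast; ring
      have hb2 : ((n + 1 : ℕ) : ℝ) * b = ((n:ℝ) + 1) * α / 2 := by
        rw [hb]; push_cast; ring
      have hb3 : π * ((n + 1 : ℕ) : ℝ) * b = π * ((n:ℝ) + 1) * α / 2 := by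
        rw [hb]; push_cast; ring
      rw [hq, hb3, hb2, etaTerm, hG, pow_succ]
      field_simp
    rw [hfun]
    exact hk
  rw [eta, hsum.tsum_eq]
  ring

lemma sd_norm_exp_neg (b y δ t : ℝ) (ht : 0 ≤ t) (hδ : δ ≤ Real.cos (b * y)) :
    ‖Complex.exp (-((t : ℂ) * Complex.exp (((b * y : ℝ) : ℂ) * Complex.I)))‖ ≤
      Real.exp (-δ * t) := by
  rw [Complex.norm_exp, Real.exp_le_exp, Complex.neg_re, Complex.re_ofReal_mul,
    Complex.exp_ofReal_mul_I_re]
  nlinarith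

lemma sd_exp_split (b x y : ℝ) : Complex.exp ((b : ℂ) * ((x : ℂ) + (y : ℂ) * Complex.I)) =
    (((Real.exp x) ^ b : ℝ) : ℂ) * Complex.exp (((b * y : ℝ) : ℂ) * Complex.I) := by
  rw [← Real.exp_mul, Complex.ofReal_exp, ← Complex.exp_add]
  congr 1
  push_cast
  ring

lemma sd_int1 (b p : ℝ) (hb : 0 < b) (hp0 : 0 < p) (hbp : b * p < π / 2) (f : ℝ → ℂ) (C : ℝ)
    (hf : ContinuousOn f (Set.Ioi 0)) (hC : ∀ s, 0 < s → ‖f s‖ ≤ C) :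
    IntegrableOn (fun s : ℝ => f s *
      Complex.exp (-(((s ^ b : ℝ) : ℂ) * Complex.exp (((b * p : ℝ) : ℂ) * Complex.I))))
      (Set.Ioi 0) := by
  have hδ : 0 < Real.cos (b * p) :=
    Real.cos_pos_of_mem_Ioo ⟨by nlinarith [Real.pi_pos, mul_pos hb hp0], hbp⟩
  have hcont : Continuous (fun s : ℝ => s ^ b) := Real.continuous_rpow_const hb.le
  refine Integrable.mono' ((sd_intA b _ hb hδ).const_mul C) ?_ ?_
  · refine ContinuousOn.aestronglyMeasurable (hf.mul ?_) measurableSet_Ioi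
    apply Continuous.continuousOn
    fun_prop
  · refine (ae_restrict_iff' measurableSet_Ioi).2 (Filter.Eventually.of_forall ?_)
    intro s (hs : 0 < s)
    rw [norm_mul]
    exact mul_le_mul (hC s hs) (sd_norm_exp_neg b p _ _ (Real.rpow_nonneg hs.le b) le_rfl)
      (norm_nonneg _) ((norm_nonneg _).trans (hC s hs))

open Filter Topology in
lemma sd_rotate (b u p : ℝ) (hb : 0 < b) (hb1 : b < 1) (hu : 0 < u) (hp : π / 2 < p) (hp1 : p < π)
    (hbp : b * p < π / 2) :
    ∫ s in Set.Ioi (0:ℝ),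
      Complex.exp (-(((s ^ b : ℝ) : ℂ) * Complex.exp (((π * b : ℝ) : ℂ) * Complex.I))) *
        ((Real.exp (-u * s) : ℝ) : ℂ) =
    ∫ s in Set.Ioi (0:ℝ), (-Complex.exp (p * Complex.I) *
        Complex.exp (u * s * Complex.exp (p * Complex.I))) *
      Complex.exp (-(((s ^ b : ℝ) : ℂ) * Complex.exp (((b * p : ℝ) : ℂ) * Complex.I))) := by
  have hpi := Real.pi_pos
  have hcont : Continuous (fun s : ℝ => s ^ b) := Real.continuous_rpow_const hb.le
  set v := u * Real.cos (p - π) with hv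
  have hcos : 0 < Real.cos (p - π) := Real.cos_pos_of_mem_Ioo ⟨by linarith, by linarith⟩
  have hv0 : 0 < v := mul_pos hu hcos
  have hcp : Real.cos p < 0 := by
    have := Real.cos_sub_pi p
    linarith
  have hg0 : IntegrableOn (fun s : ℝ =>
      Complex.exp (-(((s ^ b : ℝ) : ℂ) * Complex.exp (((π * b : ℝ) : ℂ) * Complex.I))) *
        ((Real.exp (-u * s) : ℝ) : ℂ)) (Set.Ioi 0) := by
    refine Integrable.mono' (sd_intB b u hb hb1 hu) ?_ ?_
    · apply Continuous.aestronglyMeasurable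
      fun_prop
    · refine (ae_restrict_iff' measurableSet_Ioi).2 (Filter.Eventually.of_forall ?_)
      intro s (hs : 0 < s)
      rw [norm_mul, Complex.norm_real, Real.norm_of_nonneg (Real.exp_nonneg _)]
      refine mul_le_mul_of_nonneg_right ?_ (Real.exp_nonneg _)
      have := sd_norm_exp_neg b π (-1) (s ^ b) (Real.rpow_nonneg hs.le b) (Real.neg_one_le_cos _)
      rw [mul_comm b π] at this
      simpa using this
  have hg1 := sd_int1 b p hb (by linarith) hbp (fun s : ℝ => -Complex.exp (p * Complex.I) *
        Complex.exp (u * s * Complex.exp (p * Complex.I))) 1 (by fun_prop) (by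
    intro s hs
    rw [norm_mul, norm_neg, Complex.norm_exp_ofReal_mul_I, one_mul, Complex.norm_exp,
      Real.exp_le_one_iff, ← Complex.ofReal_mul, Complex.re_ofReal_mul,
      Complex.exp_ofReal_mul_I_re]
    nlinarith [mul_pos hu hs])
  have t0 := sd_cov _ hg0
  have t1 := sd_cov _ hg1
  have tr := sd_rot (fun w => Complex.exp w * Complex.exp (-(u * Complex.exp w)) *
      Complex.exp (-Complex.exp (b * (w + π * Complex.I))))
    (fun t => t * (Real.exp (t ^ b) * Real.exp (-v * t))) (p - π) 0 (by linarith)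
    (Differentiable.differentiableOn (by fun_prop)) 1 one_pos ?_ ?_ ?_
  · have t2 := t1.sub t0
    have := tendsto_nhds_unique (t2.congr ?_) tr
    · exact (sub_eq_zero.1 this).symm
    · intro R
      congr 1
      · apply intervalIntegral.integral_congr
        intro x _
        simp only
        have e1 : Complex.exp ((x : ℂ) + ((p - π : ℝ) : ℂ) * Complex.I) =
            (Real.exp x : ℂ) * -Complex.exp (p * Complex.I) := by
          push_cast
          rw [show (x : ℂ) + (p - π) * Complex.I = x + p * Complex.I - π * Complex.I by ring,
            Complex.exp_sub, Complex.exp_pi_mul_I, Complex.exp_add]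
          ring
        have e2 : Complex.exp (b * ((x : ℂ) + ((p - π : ℝ) : ℂ) * Complex.I + π * Complex.I)) =
            (((Real.exp x) ^ b : ℝ) : ℂ) * Complex.exp (((b * p : ℝ) : ℂ) * Complex.I) := by
          rw [← sd_exp_split]
          congr 1
          push_cast; ring
        rw [e1, e2]
        rw [show -((u:ℂ) * ((Real.exp x : ℂ) * -Complex.exp (p * Complex.I))) =
          u * (Real.exp x : ℂ) * Complex.exp (p * Complex.I) by ring]
        ring
      · apply intervalIntegral.integral_congr
        intro x _
        simp only
        have e2 : Complex.exp (b * ((x : ℂ) + ((0 : ℝ) : ℂ) * Complex.I + π * Complex.I)) =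
            (((Real.exp x) ^ b : ℝ) : ℂ) * Complex.exp (((π * b : ℝ) : ℂ) * Complex.I) := by
          rw [mul_comm π b, ← sd_exp_split]
          congr 1
          push_cast; ring
        rw [e2]
        simp only [Complex.ofReal_zero, zero_mul, add_zero]
        push_cast
        rw [neg_mul]
        ring
  · intro x y hy _
    have e2 : Complex.exp (b * ((x : ℂ) + (y : ℂ) * Complex.I + π * Complex.I)) =
        (((Real.exp x) ^ b : ℝ) : ℂ) *
          Complex.exp (((b * (y + π) : ℝ) : ℂ) * Complex.I) := by
      rw [← sd_exp_split]
      congr 1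
      push_cast; ring
    have n1 : ‖Complex.exp (-Complex.exp (b * ((x : ℂ) + (y : ℂ) * Complex.I + π * Complex.I)))‖
        ≤ Real.exp ((Real.exp x) ^ b) := by
      rw [e2]
      have := sd_norm_exp_neg b (y + π) (-1) ((Real.exp x) ^ b) (by positivity)
        (Real.neg_one_le_cos _)
      simpa using this
    have n2 : ‖Complex.exp (-(u * Complex.exp ((x : ℂ) + (y : ℂ) * Complex.I)))‖
        ≤ Real.exp (-v * Real.exp x) := by
      rw [Complex.norm_exp, Real.exp_le_exp, Complex.neg_re, Complex.re_ofReal_mul,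
        Complex.exp_re]
      have hc : Real.cos (p - π) ≤ Real.cos y := by
        rw [← Real.cos_neg (p - π), ← Real.cos_neg y]
        apply Real.cos_le_cos_of_nonneg_of_le_pi <;> linarith [hy.1, hy.2]
      simp only [Complex.add_re, Complex.ofReal_re, Complex.mul_re, Complex.I_re, mul_zero,
        Complex.ofReal_im, Complex.I_im, mul_one, sub_self, add_zero, Complex.add_im,
        Complex.mul_im, zero_add]
      rw [hv]
      nlinarith [mul_le_mul_of_nonneg_left hc (mul_pos hu (Real.exp_pos x)).le]
    have n0 : ‖Complex.exp ((x : ℂ) + (y : ℂ) * Complex.I)‖ = Real.exp x := by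
      rw [Complex.norm_exp]; simp
    rw [norm_mul, norm_mul, n0, mul_assoc, mul_comm (Real.exp (Real.exp x ^ b))]
    gcongr
  · have h1 : Tendsto (fun x : ℝ => x ^ (-(1 - b))) atTop (nhds 0) :=
      tendsto_rpow_neg_atTop (by linarith)
    have h2 : ∀ᶠ x : ℝ in atTop, x ^ (-(1 - b)) < v / 2 :=
      h1.eventually (gt_mem_nhds (by positivity))
    have h3 : Tendsto (fun x : ℝ => x ^ (1:ℝ) * Real.exp (-(v / 2) * x)) atTop (𝓝 0) :=
      tendsto_rpow_mul_exp_neg_mul_atTop_nhds_zero 1 (v / 2) (by positivity)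
    refine squeeze_zero' ?_ ?_ h3
    · filter_upwards [eventually_gt_atTop 0] with x hx
      positivity
    · filter_upwards [h2, eventually_gt_atTop 0] with x hx hx0
      rw [Real.rpow_one, ← Real.exp_add]
      gcongr
      have : x ^ b = x ^ (-(1 - b)) * x := by
        rw [← Real.rpow_add_one hx0.ne']; congr 1; ring
      rw [this]
      nlinarith
  · have hc : Continuous (fun t : ℝ => t * (Real.exp (t ^ b) * Real.exp (-v * t))) := by fun_prop
    have := (hc.tendsto 0).mono_left (nhdsWithin_le_nhds (s := Set.Ioi 0))
    simpa using this

open Filter Topology in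
lemma sd_contour (b l p : ℝ) (hb : 0 < b) (hl : 0 < l) (hp : π / 2 < p) (hp1 : p < π)
    (hbp : b * p < π / 2) :
    (∫ s in Set.Ioi (0:ℝ), (Complex.exp (p * Complex.I) / (l - s * Complex.exp (p * Complex.I))) *
      Complex.exp (-(((s ^ b : ℝ) : ℂ) * Complex.exp (((b * p : ℝ) : ℂ) * Complex.I)))).im
      = π * Real.exp (-(l ^ b)) := by
  have hpi := Real.pi_pos
  set ω := Complex.exp (p * Complex.I) with hω
  have hωn : ‖ω‖ = 1 := Complex.norm_exp_ofReal_mul_I p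
  have hωre : ω.re < 0 := by
    rw [hω, Complex.exp_ofReal_mul_I_re]
    exact Real.cos_neg_of_pi_div_two_lt_of_lt hp (by linarith)
  have hωim : 0 < ω.im := by
    rw [hω, Complex.exp_ofReal_mul_I_im]
    exact Real.sin_pos_of_pos_of_lt_pi (by linarith) hp1
  obtain ⟨hr1, hr2⟩ := sd_ray l hl ω hωn hωre hωim
  set c := Real.exp (-(l ^ b)) with hc
  have hlow : ∀ s : ℝ, 0 < s → l ≤ ‖(l - s * ω : ℂ)‖ := by
    intro s hs
    have := Complex.re_le_norm (l - s * ω : ℂ)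
    simp at this
    nlinarith
  have hne : ∀ s : ℝ, 0 < s → (l - s * ω : ℂ) ≠ 0 := fun s hs => by
    rw [← norm_pos_iff]; linarith [hlow s hs]
  have hX := sd_int1 b p hb (by linarith) hbp (fun s : ℝ => ω / (l - s * ω)) (1 / l)
    (by
      refine ContinuousOn.div continuousOn_const (by fun_prop) ?_
      exact fun s hs => hne s hs)
    (by
      intro s hs
      rw [norm_div, hωn]
      exact one_div_le_one_div_of_le hl (hlow s hs))
  set X := ∫ s in Set.Ioi (0:ℝ), (ω / (l - s * ω)) *
      Complex.exp (-(((s ^ b : ℝ) : ℂ) * Complex.exp (((b * p : ℝ) : ℂ) * Complex.I))) with hXdef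
  let k : ℂ → ℂ := fun z => Complex.exp (-Complex.exp (b * Complex.log z)) - c * (2 * l / (l + z))
  have hlC : (l : ℂ) ≠ 0 := by exact_mod_cast hl.ne'
  have hk0 : k l = 0 := by
    have e : Complex.exp (b * Complex.log l) = ((l ^ b : ℝ) : ℂ) := by
      rw [Real.rpow_def_of_pos hl, ← Complex.ofReal_log hl.le]
      push_cast
      rw [mul_comm]
    simp only [k]
    rw [e, hc, ← two_mul, div_self (mul_ne_zero two_ne_zero hlC)]
    push_cast
    ring
  have hkd : DifferentiableOn ℂ k Complex.slitPlane := by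
    intro z hz
    refine DifferentiableAt.differentiableWithinAt ?_
    have h1 : DifferentiableAt ℂ Complex.log z := Complex.differentiableAt_log hz
    have h2 : (l : ℂ) + z ≠ 0 := by
      intro h
      have : z = ((-l : ℝ) : ℂ) := by push_cast; linear_combination h
      rw [this, Complex.ofReal_mem_slitPlane] at hz
      linarith
    have h3 : DifferentiableAt ℂ (fun z : ℂ => 2 * (l:ℂ) / (l + z)) z :=
      DifferentiableAt.div (by fun_prop) (by fun_prop) h2
    simp only [k]
    fun_prop
  have hsl : (l : ℂ) ∈ Complex.slitPlane := Complex.ofReal_mem_slitPlane.2 hl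
  have hdd := (Complex.differentiableOn_dslope (Complex.isOpen_slitPlane.mem_nhds hsl)).2 hkd
  let H : ℂ → ℂ := fun w => -(Complex.exp w * dslope k l (Complex.exp w))
  have hHne : ∀ w : ℂ, Complex.exp w ≠ l →
      H w = Complex.exp w * (k (Complex.exp w) / (l - Complex.exp w)) := by
    intro w hw
    have h1 : (l : ℂ) - Complex.exp w ≠ 0 := sub_ne_zero.2 hw.symm
    have h2 : Complex.exp w - l ≠ 0 := sub_ne_zero.2 hw
    simp only [H]
    rw [dslope_of_ne _ hw, slope_def_field, hk0]
    field_simp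
    ring
  have hlog : ∀ w : ℂ, w.im ∈ Set.Icc 0 p → Complex.log (Complex.exp w) = w := fun w hw =>
    Complex.log_exp (by linarith [hw.1]) (by linarith [hw.2])
  have hk : ∀ x y : ℝ, y ∈ Set.Icc 0 p → k (Complex.exp (x + y * Complex.I)) =
      Complex.exp (-(((Real.exp x ^ b : ℝ) : ℂ) * Complex.exp (((b * y : ℝ) : ℂ) * Complex.I))) -
        c * (2 * l / (l + Complex.exp (x + y * Complex.I))) := by
    intro x y hy
    simp only [k]
    rw [hlog _ (by simpa using hy), sd_exp_split]
  have hδ : 0 < Real.cos (b * p) :=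
    Real.cos_pos_of_mem_Ioo ⟨by nlinarith, hbp⟩
  have hn0 : ∀ x y : ℝ, ‖Complex.exp ((x : ℂ) + (y : ℂ) * Complex.I)‖ = Real.exp x := by
    intro x y
    rw [Complex.norm_exp]; simp
  have tr := sd_rot H (fun t => t * ((Real.exp (-Real.cos (b * p) * t ^ b) +
      c * (2 * l / |l - t|)) / |l - t|)) 0 p (by linarith) ?_ l hl ?_ ?_ ?_
  · -- conclusion
    have t1 := sd_cov _ (hX.sub (hr1.const_mul (c:ℂ)))
    simp only [Pi.sub_apply] at t1
    rw [integral_sub hX (hr1.const_mul (c:ℂ)), integral_const_mul, hr2, ← hXdef] at t1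
    have hbot : ∀ R : ℝ, (∫ x in (-R)..R, H (x + ((0:ℝ):ℂ) * Complex.I)).im = 0 := by
      intro R
      have : (∫ x in (-R)..R, H (x + ((0:ℝ):ℂ) * Complex.I)) =
          ∫ x in (-R)..R, (((H (x + ((0:ℝ):ℂ) * Complex.I)).re : ℝ) : ℂ) := by
        apply intervalIntegral.integral_congr_ae
        have : ∀ᵐ x : ℝ, x ≠ Real.log l := by
          simp [ae_iff]
        filter_upwards [this] with x hx _
        have hx' : Real.exp x ≠ l := by
          intro h; apply hx; rw [← h, Real.log_exp]
        have hxC : Complex.exp (x + ((0:ℝ):ℂ) * Complex.I) = (Real.exp x : ℂ) := by simp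
        rw [hHne _ (by rw [hxC]; exact_mod_cast hx'), hk x 0 ⟨le_rfl, by linarith⟩, hxC]
        have : ((Real.exp x : ℂ) * ((Complex.exp (-(((Real.exp x ^ b : ℝ) : ℂ) *
            Complex.exp (((b * 0 : ℝ) : ℂ) * Complex.I))) -
            c * (2 * l / (l + (Real.exp x : ℂ)))) / (l - (Real.exp x : ℂ)))) =
            ((Real.exp x * ((Real.exp (-(Real.exp x ^ b)) - c * (2 * l / (l + Real.exp x))) /
              (l - Real.exp x)) : ℝ) : ℂ) := by
          simp only [mul_zero, Complex.ofReal_zero, zero_mul, Complex.exp_zero, mul_one]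
          push_cast
          rfl
        rw [this, Complex.ofReal_re]
      rw [this, intervalIntegral.integral_ofReal, Complex.ofReal_im]
    have t2 := (Complex.continuous_im.tendsto _).comp (tr.add t1)
    have t3 : Tendsto (fun _ : ℝ => (0:ℝ)) atTop (𝓝 (0 + (X - c * (π * Complex.I))).im) := by
      refine t2.congr ?_
      intro R
      simp only [Function.comp]
      refine Eq.trans (congrArg Complex.im ?_) (hbot R)
      rw [sub_add_eq_add_sub, add_sub_assoc, add_eq_left, sub_eq_zero]
      apply intervalIntegral.integral_congr
      intro x _
      simp only
      have e1 : Complex.exp ((x : ℂ) + (p : ℂ) * Complex.I) = (Real.exp x : ℂ) * ω := by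
        rw [Complex.exp_add, Complex.ofReal_exp]
      have h1 := hne (Real.exp x) (Real.exp_pos x)
      rw [hHne, hk x p ⟨by linarith, le_rfl⟩, e1]
      · rw [← div_div, ← sub_eq_zero]
        ring
      · rw [e1]; exact fun h => h1 (sub_eq_zero.2 h.symm)
    have := tendsto_nhds_unique t3 tendsto_const_nhds
    simp at this
    linarith
  · have hmap : Set.MapsTo Complex.exp {w : ℂ | w.im ∈ Set.Icc 0 p} Complex.slitPlane := by
      intro w hw
      rw [Complex.mem_slitPlane_iff_arg]
      refine ⟨?_, Complex.exp_ne_zero _⟩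
      rw [← Complex.log_im, hlog w hw]
      linarith [hw.2]
    exact (Complex.differentiable_exp.differentiableOn.mul
      (hdd.comp Complex.differentiable_exp.differentiableOn hmap)).neg
  · intro x y hy hx
    have hn := hn0 x y
    set z := Complex.exp ((x : ℂ) + (y : ℂ) * Complex.I) with hz
    have hzne : z ≠ l := by
      intro h
      apply hx
      rw [← hn, h, Complex.norm_real, Real.norm_of_nonneg hl.le]
    have hpos : 0 < |l - Real.exp x| := abs_pos.2 (sub_ne_zero.2 hx.symm)
    have a1 : |l - Real.exp x| ≤ ‖(l : ℂ) - z‖ := by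
      have := abs_norm_sub_norm_le (l : ℂ) z
      rwa [hn, Complex.norm_real, Real.norm_of_nonneg hl.le] at this
    have a2 : |l - Real.exp x| ≤ ‖(l : ℂ) + z‖ := by
      have := abs_norm_sub_norm_le (l : ℂ) (-z)
      rwa [norm_neg, hn, Complex.norm_real, Real.norm_of_nonneg hl.le, sub_neg_eq_add] at this
    rw [hHne _ hzne, norm_mul, hn, norm_div]
    have hcos : Real.cos (b * p) ≤ Real.cos (b * y) := by
      apply Real.cos_le_cos_of_nonneg_of_le_pi
      · exact mul_nonneg hb.le hy.1
      · linarith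
      · exact mul_le_mul_of_nonneg_left hy.2 hb.le
    have a3 := sd_norm_exp_neg b y _ (Real.exp x ^ b) (by positivity) hcos
    have a4 : ‖(c : ℂ) * (2 * l / (l + z))‖ ≤ c * (2 * l / |l - Real.exp x|) := by
      have hc0 : 0 ≤ c := Real.exp_nonneg _
      rw [norm_mul, norm_div, norm_mul, Complex.norm_real, Complex.norm_real,
        Real.norm_of_nonneg hl.le, Real.norm_of_nonneg hc0, Complex.norm_ofNat]
      gcongr
    have a5 : ‖k z‖ ≤ Real.exp (-Real.cos (b * p) * Real.exp x ^ b) +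
        c * (2 * l / |l - Real.exp x|) := by
      rw [hz, hk x y hy]
      exact (norm_sub_le _ _).trans (add_le_add a3 a4)
    have := (norm_nonneg _).trans a5
    gcongr
  · have q1 : Tendsto (fun t : ℝ => (|l - t|)⁻¹) atTop (𝓝 0) := by
      apply tendsto_inv_atTop_zero.comp
      apply tendsto_abs_atBot_atTop.comp
      exact tendsto_atBot_add_const_left _ l tendsto_neg_atTop_atBot
    have q2 : Tendsto (fun t : ℝ => t * (|l - t|)⁻¹) atTop (𝓝 1) := by
      have : Tendsto (fun t : ℝ => 1 + l * (|l - t|)⁻¹) atTop (𝓝 (1 + l * 0)) :=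
        (q1.const_mul l).const_add 1
      simp only [mul_zero, add_zero] at this
      refine this.congr' ?_
      filter_upwards [eventually_gt_atTop l] with t ht
      rw [abs_of_neg (by linarith)]
      have : l - t ≠ 0 := by linarith
      field_simp
      ring
    have q3 : Tendsto (fun t : ℝ => Real.exp (-Real.cos (b * p) * t ^ b)) atTop (𝓝 0) := by
      apply Real.tendsto_exp_atBot.comp
      exact (tendsto_rpow_atTop hb).const_mul_atTop_of_neg (by linarith)
    have := q2.mul (q3.add ((q1.const_mul (2 * l)).const_mul c))
    simp only [mul_zero, add_zero] at this
    refine this.congr ?_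
    intro t
    simp only [div_eq_mul_inv]
    ring
  · have hcont : Continuous (fun s : ℝ => s ^ b) := Real.continuous_rpow_const hb.le
    have hca : ContinuousAt (fun t : ℝ => t * ((Real.exp (-Real.cos (b * p) * t ^ b) +
      c * (2 * l / |l - t|)) / |l - t|)) 0 := by
      have : |l - 0| ≠ 0 := by simpa using hl.ne'
      fun_prop (disch := assumption)
    have := hca.tendsto.mono_left (nhdsWithin_le_nhds (s := Set.Ioi 0))
    simpa using this

/-- For `α ∈ (0,2)` and `λ > 0`, the function `u ↦ e^{-λu} η₁^{(α/2)}(u)` is Lebesgue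
integrable on `(0,∞)` and its integral equals `e^{-λ^{α/2}}`: the `α/2`-stable subordinator
has Laplace exponent `λ ↦ λ^{α/2}`. -/
theorem stable_density_laplace_transform (α l : ℝ) (hα : α ∈ Set.Ioo (0:ℝ) 2) (hl : 0 < l) :
    IntegrableOn (fun u => Real.exp (-l * u) * eta α u) (Set.Ioi (0:ℝ))
      ∧ ∫ u in Set.Ioi (0:ℝ), Real.exp (-l * u) * eta α u = Real.exp (-(l ^ (α / 2))) := by
  have hpi := Real.pi_pos
  have heta := fun u (hu : 0 < u) => sd_eta α u hα hu
  obtain ⟨h0, h2⟩ := hα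
  set b := α / 2 with hb
  have hb0 : 0 < b := by positivity
  have hb1 : b < 1 := by linarith
  obtain ⟨p, hp, hp'⟩ : ∃ p, π / 2 < p ∧ p < min π (π / 2 / b) := by
    apply exists_between
    rw [lt_min_iff]
    refine ⟨by linarith, ?_⟩
    rw [lt_div_iff₀ hb0]
    nlinarith
  obtain ⟨hp1, hp2⟩ := lt_min_iff.1 hp'
  have hbp : b * p < π / 2 := by
    rw [lt_div_iff₀ hb0] at hp2; linarith
  have hcont : Continuous (fun s : ℝ => s ^ b) := Real.continuous_rpow_const hb0.le
  have hcp : Real.cos p < 0 := Real.cos_neg_of_pi_div_two_lt_of_lt hp (by linarith)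
  have hδ : 0 < Real.cos (b * p) := Real.cos_pos_of_mem_Ioo ⟨by nlinarith, hbp⟩
  set ω := Complex.exp (p * Complex.I) with hω
  have hωn : ‖ω‖ = 1 := Complex.norm_exp_ofReal_mul_I p
  have hωre : ω.re = Real.cos p := Complex.exp_ofReal_mul_I_re p
  let K : ℝ → ℝ → ℂ := fun u s => (Real.exp (-l * u) : ℂ) * ((-ω * Complex.exp (u * s * ω)) *
      Complex.exp (-(((s ^ b : ℝ) : ℂ) * Complex.exp (((b * p : ℝ) : ℂ) * Complex.I))))
  have hK : Integrable (Function.uncurry K)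
      ((volume.restrict (Set.Ioi (0:ℝ))).prod (volume.restrict (Set.Ioi (0:ℝ)))) := by
    have hbd : Integrable (fun z : ℝ × ℝ => Real.exp (-l * z.1) *
        Real.exp (-Real.cos (b * p) * z.2 ^ b))
        ((volume.restrict (Set.Ioi (0:ℝ))).prod (volume.restrict (Set.Ioi (0:ℝ)))) :=
      Integrable.mul_prod (exp_neg_integrableOn_Ioi 0 hl) (sd_intA b _ hb0 hδ)
    refine Integrable.mono' hbd ?_ ?_
    · apply Continuous.aestronglyMeasurable
      simp only [K, Function.uncurry]
      fun_prop
    · rw [Measure.prod_restrict]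
      refine (ae_restrict_iff' (measurableSet_Ioi.prod measurableSet_Ioi)).2
        (Filter.Eventually.of_forall ?_)
      rintro ⟨u, s⟩ ⟨hu, hs⟩
      have hu : 0 < u := hu
      have hs : 0 < s := hs
      simp only [K, Function.uncurry]
      rw [norm_mul, norm_mul, Complex.norm_real, Real.norm_of_nonneg (Real.exp_nonneg _)]
      gcongr
      have n1 : ‖-ω * Complex.exp (u * s * ω)‖ ≤ 1 := by
        rw [norm_mul, norm_neg, hωn, one_mul, Complex.norm_exp,
          Real.exp_le_one_iff, ← Complex.ofReal_mul, Complex.re_ofReal_mul, hωre]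
        nlinarith [mul_pos hu hs]
      have n2 := sd_norm_exp_neg b p _ (s ^ b) (Real.rpow_nonneg hs.le b) le_rfl
      calc _ ≤ 1 * Real.exp (-Real.cos (b * p) * s ^ b) :=
            mul_le_mul n1 n2 (norm_nonneg _) zero_le_one
        _ = _ := one_mul _
  have hI := hK.integral_prod_left
  have heq : Set.EqOn (fun u => -(1 / π) * (∫ s in Set.Ioi (0:ℝ), K u s).im)
      (fun u => Real.exp (-l * u) * eta α u) (Set.Ioi 0) := by
    intro u hu
    simp only [K]
    rw [heta u hu, sd_rotate b u p hb0 hb1 hu hp hp1 hbp, integral_const_mul,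
      Complex.im_ofReal_mul]
    ring
  have hIm : IntegrableOn (fun u => -(1 / π) * (∫ s in Set.Ioi (0:ℝ), K u s).im) (Set.Ioi 0) :=
    (Integrable.im hI).const_mul _
  refine ⟨hIm.congr_fun heq measurableSet_Ioi, ?_⟩
  rw [← setIntegral_congr_fun measurableSet_Ioi heq, integral_const_mul]
  have him : ∫ u in Set.Ioi (0:ℝ), (∫ s in Set.Ioi (0:ℝ), K u s).im =
      (∫ u in Set.Ioi (0:ℝ), ∫ s in Set.Ioi (0:ℝ), K u s).im := integral_im hI
  rw [him, integral_integral_swap hK]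
  have hin : ∀ s ∈ Set.Ioi (0:ℝ), (∫ u in Set.Ioi (0:ℝ), K u s) =
      -((ω / (l - s * ω)) *
      Complex.exp (-(((s ^ b : ℝ) : ℂ) * Complex.exp (((b * p : ℝ) : ℂ) * Complex.I)))) := by
    intro s (hs : 0 < s)
    have hre : (s * ω - l : ℂ).re < 0 := by
      rw [Complex.sub_re, Complex.re_ofReal_mul, hωre, Complex.ofReal_re]
      nlinarith
    have hne : (s * ω - l : ℂ) ≠ 0 := by
      intro h; rw [h] at hre; simp at hre
    have hne' : (l - s * ω : ℂ) ≠ 0 := by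
      intro h; apply hne; linear_combination -h
    have := integral_exp_mul_complex_Ioi hre 0
    have e : ∀ u : ℝ, K u s = (-ω * Complex.exp (-(((s ^ b : ℝ) : ℂ) *
        Complex.exp (((b * p : ℝ) : ℂ) * Complex.I)))) * Complex.exp ((s * ω - l) * u) := by
      intro u
      simp only [K]
      rw [show (s * ω - l) * (u : ℂ) = ((-l * u : ℝ) : ℂ) + u * s * ω by push_cast; ring,
        Complex.exp_add, Complex.ofReal_exp]
      ring
    simp_rw [e]
    rw [integral_const_mul, this, Complex.ofReal_zero, mul_zero, Complex.exp_zero,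
      ← neg_sub (l : ℂ) (s * ω), neg_div_neg_eq]
    ring
  rw [setIntegral_congr_fun measurableSet_Ioi hin, integral_neg, Complex.neg_im,
    sd_contour b l p hb0 hl hp hp1 hbp]
  field_simp
end

section
/- Let α ∈ (0, 2). The function η₁^{(α/2)} defined by its convergent series representation is Lebesgue integrable on (0,∞) and ∫₀^∞ η₁^{(α/2)}(u) du = 1; that is, it is a probability density on (0,∞). -/
open Real MeasureTheory

open Set Filter Topology in
lemma rot_aux (K G D : ℝ → ℝ → ℂ) (a b : ℝ) (hab : a ≤ b) (g : ℝ → ℝ)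
    (hg : IntegrableOn g (Ioi 0))
    (hK : ∀ t > 0, ∀ ψ : ℝ, HasDerivAt (fun ψ => K ψ t) (D ψ t) ψ)
    (hG : ∀ t > 0, ∀ ψ : ℝ, HasDerivAt (G ψ) (D ψ t) t)
    (hGc : ∀ ψ, ContinuousWithinAt (G ψ) (Ici 0) 0)
    (hGi : ∀ ψ ∈ Icc a b, Tendsto (G ψ) atTop (𝓝 0))
    (hD : ∀ ψ ∈ Icc a b, ∀ t > 0, ‖D ψ t‖ ≤ g t)
    (hDm : Measurable (Function.uncurry D))
    (hDc : ∀ t > 0, Continuous fun ψ => D ψ t) :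
    (∀ t > 0, ‖K b t - K a t‖ ≤ (b - a) * g t) ∧
    ∫ t in Ioi (0:ℝ), (K b t - K a t) = - ∫ ψ in a..b, G ψ 0 := by
  have key : ∀ t > 0, K b t - K a t = ∫ ψ in a..b, D ψ t := by
    intro t ht
    rw [intervalIntegral.integral_eq_sub_of_hasDerivAt (f := fun ψ => K ψ t)
      (fun ψ _ => hK t ht ψ) ((hDc t ht).intervalIntegrable a b)]
  constructor
  · intro t ht
    rw [key t ht]
    refine (intervalIntegral.norm_integral_le_of_norm_le_const (C := g t) ?_).trans ?_
    · intro ψ hψ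
      rw [uIoc_of_le hab] at hψ
      exact hD ψ (Ioc_subset_Icc_self hψ) t ht
    · rw [abs_of_nonneg (by linarith), mul_comm]
  · have hint : Integrable (Function.uncurry D)
        ((volume.restrict (Set.uIoc a b)).prod (volume.restrict (Ioi (0:ℝ)))) := by
      have h1 : Integrable (fun p : ℝ × ℝ => (1:ℝ) * g p.2)
          ((volume.restrict (Set.uIoc a b)).prod (volume.restrict (Ioi (0:ℝ)))) := by
        apply Integrable.mul_prod (f := fun _ => (1:ℝ)) (g := g) _ hg
        rw [uIoc_of_le hab]
        exact integrable_const _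
      refine h1.mono' hDm.aestronglyMeasurable ?_
      rw [Measure.prod_restrict, ae_restrict_iff' (measurableSet_uIoc.prod measurableSet_Ioi)]
      refine ae_of_all _ ?_
      rintro ⟨ψ, t⟩ ⟨h1, h2⟩
      rw [uIoc_of_le hab] at h1
      simpa [Function.uncurry] using hD ψ (Ioc_subset_Icc_self h1) t h2
    rw [setIntegral_congr_fun measurableSet_Ioi (fun t ht => key t ht),
      ← MeasureTheory.intervalIntegral_integral_swap (f := D) hint, ← intervalIntegral.integral_neg]
    refine intervalIntegral.integral_congr ?_
    intro ψ hψ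
    rw [uIcc_of_le hab] at hψ
    have hi : IntegrableOn (D ψ) (Ioi 0) := by
      refine hg.mono' ((hDm.comp measurable_prodMk_left).aestronglyMeasurable) ?_
      rw [ae_restrict_iff' measurableSet_Ioi]
      exact ae_of_all _ fun t ht => hD ψ hψ t ht
    simpa using! integral_Ioi_of_hasDerivAt_of_tendsto (hGc ψ) (fun t ht => hG t ht ψ) hi (hGi ψ hψ)

lemma gamma_summable (β : ℝ) (h0 : 0 < β) (h1 : β < 1) (x : ℝ) (hx : 0 < x) :
    Summable fun n : ℕ => Real.Gamma ((n:ℝ) * β + 1) / (n.factorial : ℝ) * x ^ ((n:ℝ) * β + 1) := by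
  have hs : Summable fun n : ℕ => ((n.factorial : ℝ) ^ (1 - β))⁻¹ * x ^ ((n:ℝ) * β + 1) := by
    refine summable_of_ratio_test_tendsto_lt_one (l := 0) one_pos
      (Filter.Eventually.of_forall fun n => by positivity) ?_
    have h : ∀ n : ℕ, ‖(((n+1).factorial : ℝ) ^ (1 - β))⁻¹ * x ^ (((n+1:ℕ):ℝ) * β + 1)‖ /
        ‖((n.factorial : ℝ) ^ (1 - β))⁻¹ * x ^ ((n:ℝ) * β + 1)‖
        = x ^ β * ((n:ℝ) + 1) ^ (-(1 - β)) := by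
      intro n
      rw [Real.norm_of_nonneg (by positivity), Real.norm_of_nonneg (by positivity),
        Nat.factorial_succ, Nat.cast_mul, Real.mul_rpow (by positivity) (by positivity),
        show ((n+1:ℕ):ℝ) * β + 1 = ((n:ℝ) * β + 1) + β by push_cast; ring,
        Real.rpow_add hx, Real.rpow_neg (by positivity)]
      have := (Real.rpow_pos_of_pos (Nat.cast_pos.2 n.factorial_pos : (0:ℝ) < _) (1-β)).ne'
      have := (Real.rpow_pos_of_pos hx ((n:ℝ) * β + 1)).ne'
      push_cast
      field_simp
    simp_rw [h]
    have h2 := (tendsto_rpow_neg_atTop (y := 1 - β) (by linarith)).comp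
      (Filter.tendsto_atTop_add_const_right _ (1:ℝ) (tendsto_natCast_atTop_atTop (R := ℝ)))
    simpa using h2.const_mul (x ^ β)
  refine Summable.of_nonneg_of_le (fun n => ?_) (fun n => ?_) hs
  · have : 0 < Real.Gamma ((n:ℝ) * β + 1) := Real.Gamma_pos_of_pos (by positivity)
    positivity
  · gcongr
    have := Real.Gamma_mul_add_mul_le_rpow_Gamma_mul_rpow_Gamma (s := 1) (t := (n:ℝ) + 1)
      (a := 1 - β) (b := β) one_pos (by positivity) (by linarith) h0 (by ring)
    rw [Real.Gamma_one, Real.one_rpow, one_mul, Real.Gamma_nat_eq_factorial,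
      show (1 - β) * 1 + β * ((n:ℝ) + 1) = n * β + 1 by ring] at this
    have hf : (0:ℝ) < n.factorial := Nat.cast_pos.2 n.factorial_pos
    rw [div_le_iff₀ hf, ← Real.rpow_neg hf.le]
    refine this.trans_eq ?_
    nth_rewrite 3 [← Real.rpow_one (n.factorial : ℝ)]
    rw [← Real.rpow_add hf]
    congr 1; ring

open Set Filter Topology in
lemma ray_integral (s u θ : ℝ) (hs : 0 ≤ s) (hu : 0 < u) (hθ : 0 ≤ θ) (hθ' : θ < π / 2) :
    ∫ t in Ioi (0:ℝ), ((t ^ s : ℝ) : ℂ) *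
      Complex.exp (-((θ * (s + 1) : ℝ) : ℂ) * Complex.I - u * t * Complex.exp (-(θ:ℂ) * Complex.I))
      = ((Real.Gamma (s + 1) * (1 / u) ^ (s + 1) : ℝ) : ℂ) := by
  set e : ℝ → ℝ → ℂ := fun ψ t => Complex.exp (-((ψ * (s + 1) : ℝ) : ℂ) * Complex.I
    - u * t * Complex.exp (-(ψ:ℂ) * Complex.I)) with he
  have hne : ∀ ψ t, ‖e ψ t‖ = Real.exp (-(u * Real.cos ψ) * t) := by
    intro ψ t
    rw [he]
    simp only [Complex.norm_exp]
    congr 1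
    simp [Complex.exp_re]
    ring
  have hc : 0 < Real.cos θ := Real.cos_pos_of_mem_Ioo ⟨by linarith [Real.pi_pos], hθ'⟩
  have hcψ : ∀ ψ ∈ Icc 0 θ, Real.cos θ ≤ Real.cos ψ := fun ψ hψ =>
    Real.cos_le_cos_of_nonneg_of_le_pi hψ.1 (by linarith [Real.pi_pos]) hψ.2
  have hi : ∀ r : ℝ, 0 ≤ r → ∀ c : ℝ, 0 < c →
      IntegrableOn (fun t : ℝ => t ^ r * Real.exp (-c * t)) (Ioi 0) := by
    intro r hr c hc
    simpa using integrableOn_rpow_mul_exp_neg_mul_rpow (p := 1) (s := r) (b := c) (by linarith) one_pos hc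
  set D : ℝ → ℝ → ℂ := fun ψ t => ((t ^ s : ℝ) : ℂ) * (e ψ t *
    (-Complex.I * ((s + 1) - u * t * Complex.exp (-(ψ:ℂ) * Complex.I)))) with hDdef
  have hec : Continuous (Function.uncurry e) := by
    rw [he]; unfold Function.uncurry; fun_prop
  have main := rot_aux (fun ψ t => ((t ^ s : ℝ) : ℂ) * e ψ t)
    (fun ψ t => -Complex.I * ((t ^ (s + 1) : ℝ) : ℂ) * e ψ t) D 0 θ hθ
    (fun t => (s + 1) * (t ^ s * Real.exp (-(u * Real.cos θ) * t))
      + u * (t ^ (s + 1) * Real.exp (-(u * Real.cos θ) * t)))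
    (((hi s hs _ (by positivity)).const_mul _).add ((hi (s+1) (by linarith) _ (by positivity)).const_mul _))
    ?_ ?_ ?_ ?_ ?_ ?_ ?_
  · have h0 : ∫ t in Ioi (0:ℝ), ((t ^ s : ℝ) : ℂ) * e 0 t
        = ((Real.Gamma (s + 1) * (1 / u) ^ (s + 1) : ℝ) : ℂ) := by
      rw [mul_comm (Real.Gamma _), ← Real.integral_rpow_mul_exp_neg_mul_Ioi (by linarith) hu,
        ← integral_complex_ofReal]
      refine integral_congr_ae (ae_of_all _ fun t => ?_)
      simp [he]
    have hint : ∀ ψ ∈ Icc 0 θ, IntegrableOn (fun t : ℝ => ((t ^ s : ℝ) : ℂ) * e ψ t) (Ioi 0) := by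
      intro ψ hψ
      have hcp := lt_of_lt_of_le hc (hcψ ψ hψ)
      refine (hi s hs (u * Real.cos ψ) (by positivity)).mono' ?_ ?_
      · apply Measurable.aestronglyMeasurable
        have := (hec.measurable.comp (measurable_prodMk_left (x := ψ)))
        exact (Complex.measurable_ofReal.comp (measurable_id.pow_const s)).mul this
      · rw [ae_restrict_iff' measurableSet_Ioi]
        refine ae_of_all _ fun t ht => ?_
        rw [norm_mul, hne, Complex.norm_real, Real.norm_of_nonneg (Real.rpow_nonneg (le_of_lt ht) _)]
    have h2 := main.2
    rw [integral_sub (hint θ ⟨hθ, le_rfl⟩) (hint 0 ⟨le_rfl, hθ⟩), h0] at h2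
    have h3 : ∀ ψ : ℝ, -Complex.I * (((0:ℝ) ^ (s + 1) : ℝ) : ℂ) * e ψ 0 = 0 := by
      intro ψ
      rw [Real.zero_rpow (by linarith)]; simp
    simp only [h3, intervalIntegral.integral_zero, neg_zero] at h2
    exact sub_eq_zero.1 h2
  · -- derivative in ψ
    intro t ht ψ
    have h1 : HasDerivAt (fun ψ : ℝ => (ψ : ℂ)) 1 ψ := by
      simpa using (hasDerivAt_id ψ).ofReal_comp
    have h2 : HasDerivAt (fun ψ : ℝ => -((ψ * (s + 1) : ℝ) : ℂ) * Complex.I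
        - u * t * Complex.exp (-(ψ:ℂ) * Complex.I))
        (-(1 * (s + 1)) * Complex.I - u * t * (Complex.exp (-(ψ:ℂ) * Complex.I) * (-1 * Complex.I))) ψ := by
      push_cast
      exact ((h1.mul_const _).neg.mul_const _).sub
        (((h1.neg.mul_const Complex.I).cexp).const_mul _)
    have h3 := (h2.cexp).const_mul ((t ^ s : ℝ) : ℂ)
    refine h3.congr_deriv ?_
    simp only [hDdef, he]
    ring
  · intro t ht ψ
    have h1 : HasDerivAt (fun t : ℝ => (t : ℂ)) 1 t := by
      simpa using (hasDerivAt_id t).ofReal_comp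
    have h2 : HasDerivAt (fun t : ℝ => -((ψ * (s + 1) : ℝ) : ℂ) * Complex.I
        - u * t * Complex.exp (-(ψ:ℂ) * Complex.I))
        (- (u * 1 * (Complex.exp (-(ψ:ℂ) * Complex.I)))) t := by
      exact ((h1.const_mul (u:ℂ)).mul_const _).const_sub _
    have h4 : HasDerivAt (fun t : ℝ => ((t ^ (s + 1) : ℝ) : ℂ)) (((s + 1) * t ^ s : ℝ) : ℂ) t := by
      have := (Real.hasDerivAt_rpow_const (p := s + 1) (Or.inl (ne_of_gt ht))).ofReal_comp
      simpa using this
    have h3 := (h4.const_mul (-Complex.I)).mul (h2.cexp)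
    refine h3.congr_deriv ?_
    simp only [hDdef, he]
    rw [Real.rpow_add ht, Real.rpow_one]
    push_cast
    ring
  · intro ψ
    apply ContinuousAt.continuousWithinAt
    have : ContinuousAt (fun t : ℝ => ((t ^ (s + 1) : ℝ) : ℂ)) 0 :=
      Complex.continuous_ofReal.continuousAt.comp
        (Real.continuousAt_rpow_const _ _ (Or.inr (by linarith)))
    exact (this.const_mul _).mul (hec.comp (Continuous.prodMk_right ψ)).continuousAt
  · intro ψ hψ
    have hcp := lt_of_lt_of_le hc (hcψ ψ hψ)
    rw [tendsto_zero_iff_norm_tendsto_zero]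
    refine (tendsto_rpow_mul_exp_neg_mul_atTop_nhds_zero (s + 1) (u * Real.cos ψ) (by positivity)).congr' ?_
    filter_upwards [eventually_gt_atTop 0] with t ht
    rw [norm_mul, hne, norm_mul, Complex.norm_real, Real.norm_of_nonneg (Real.rpow_nonneg (le_of_lt ht) _)]
    simp
  · intro ψ hψ t ht
    have e1 : ‖e ψ t‖ ≤ Real.exp (-(u * Real.cos θ) * t) := by
      rw [hne]
      have := hcψ ψ hψ
      have ht' : 0 < t := ht
      gcongr
    have e2 : ‖(-Complex.I * ((s + 1) - u * t * Complex.exp (-(ψ:ℂ) * Complex.I)))‖ ≤ (s + 1) + u * t := by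
      rw [norm_mul]
      simp only [norm_neg, Complex.norm_I, one_mul]
      refine (norm_sub_le _ _).trans ?_
      have : ‖Complex.exp (-(ψ:ℂ) * Complex.I)‖ = 1 := by
        simpa using Complex.norm_exp_ofReal_mul_I (-ψ)
      rw [norm_mul, this, norm_mul, Complex.norm_real, Complex.norm_real,
        Real.norm_of_nonneg hu.le, Real.norm_of_nonneg (le_of_lt ht)]
      have : ‖(s:ℂ) + 1‖ = s + 1 := by
        rw [show (s:ℂ) + 1 = ((s + 1 : ℝ) : ℂ) by push_cast; rfl, Complex.norm_real,
          Real.norm_of_nonneg (by linarith)]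
      rw [this]; simp
    simp only [hDdef]
    rw [norm_mul, norm_mul, Complex.norm_real, Real.norm_of_nonneg (Real.rpow_nonneg (le_of_lt ht) _)]
    have hts : 0 ≤ t ^ s := Real.rpow_nonneg (le_of_lt ht) _
    calc _ ≤ t ^ s * (Real.exp (-(u * Real.cos θ) * t) * ((s + 1) + u * t)) := by gcongr
      _ = _ := by rw [Real.rpow_add ht, Real.rpow_one]; ring
  · have : Continuous (Function.uncurry fun ψ t : ℝ => (e ψ t *
      (-Complex.I * ((s + 1) - u * t * Complex.exp (-(ψ:ℂ) * Complex.I))))) := by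
      rw [he]; unfold Function.uncurry; fun_prop
    have h2 : Measurable (fun p : ℝ × ℝ => ((p.2 ^ s : ℝ) : ℂ)) :=
      Complex.measurable_ofReal.comp (measurable_snd.pow_const s)
    exact h2.mul this.measurable
  · intro t ht
    rw [hDdef, he]; fun_prop

open Set Filter Topology in
lemma frullani_rot (β a b c : ℝ) (hβ : 0 < β) (hab : a ≤ b) (hc : 0 < c)
    (hcos : ∀ ψ ∈ Icc a b, c ≤ Real.cos ψ) :
    (∀ t > 0, ‖((t⁻¹ : ℝ) : ℂ) * Complex.exp (-((t ^ β : ℝ) : ℂ) * Complex.exp ((b:ℂ) * Complex.I))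
        - ((t⁻¹ : ℝ) : ℂ) * Complex.exp (-((t ^ β : ℝ) : ℂ) * Complex.exp ((a:ℂ) * Complex.I))‖
        ≤ (b - a) * (t ^ (β - 1) * Real.exp (-c * t ^ β))) ∧
    ∫ t in Ioi (0:ℝ), (((t⁻¹ : ℝ) : ℂ) * Complex.exp (-((t ^ β : ℝ) : ℂ) * Complex.exp ((b:ℂ) * Complex.I))
        - ((t⁻¹ : ℝ) : ℂ) * Complex.exp (-((t ^ β : ℝ) : ℂ) * Complex.exp ((a:ℂ) * Complex.I)))
      = -(((b - a) / β : ℝ) : ℂ) * Complex.I := by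
  set e : ℝ → ℝ → ℂ := fun ψ t => Complex.exp (-((t ^ β : ℝ) : ℂ) * Complex.exp ((ψ:ℂ) * Complex.I)) with he
  have hne : ∀ ψ t, ‖e ψ t‖ = Real.exp (-(Real.cos ψ) * t ^ β) := by
    intro ψ t
    rw [he]
    simp only [Complex.norm_exp]
    congr 1
    rw [← Complex.ofReal_neg, Complex.re_ofReal_mul, Complex.exp_ofReal_mul_I_re]
    ring
  have hpm : Measurable (fun p : ℝ × ℝ => ((p.2 ^ β : ℝ) : ℂ)) :=
    Complex.measurable_ofReal.comp (measurable_snd.pow_const β)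
  have hpm' : Measurable (fun p : ℝ × ℝ => ((p.2 ^ (β - 1) : ℝ) : ℂ)) :=
    Complex.measurable_ofReal.comp (measurable_snd.pow_const (β - 1))
  have main := rot_aux (fun ψ t => ((t⁻¹ : ℝ) : ℂ) * e ψ t)
    (fun ψ t => (Complex.I / β) * e ψ t)
    (fun ψ t => ((t ^ (β - 1) : ℝ) : ℂ) * (e ψ t * (-Complex.I * Complex.exp ((ψ:ℂ) * Complex.I)))) a b hab
    (fun t => t ^ (β - 1) * Real.exp (-c * t ^ β))
    (integrableOn_rpow_mul_exp_neg_mul_rpow (by linarith) hβ hc)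
    ?_ ?_ ?_ ?_ ?_ ?_ ?_
  · refine ⟨main.1, main.2.trans ?_⟩
    have h3 : ∀ ψ : ℝ, Complex.I / β * e ψ 0 = Complex.I / β := by
      intro ψ
      simp [he, Real.zero_rpow hβ.ne']
    simp only [h3, intervalIntegral.integral_const]
    rw [Complex.real_smul]
    push_cast
    ring
  · intro t ht ψ
    have h1 : HasDerivAt (fun ψ : ℝ => (ψ : ℂ)) 1 ψ := by
      simpa using (hasDerivAt_id ψ).ofReal_comp
    have h2 : HasDerivAt (fun ψ : ℝ => -((t ^ β : ℝ) : ℂ) * Complex.exp ((ψ:ℂ) * Complex.I))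
        (-((t ^ β : ℝ) : ℂ) * (Complex.exp ((ψ:ℂ) * Complex.I) * (1 * Complex.I))) ψ :=
      ((h1.mul_const Complex.I).cexp).const_mul _
    have h3 := (h2.cexp).const_mul ((t⁻¹ : ℝ) : ℂ)
    refine h3.congr_deriv ?_
    simp only [he]
    have htne : (t:ℂ) ≠ 0 := by exact_mod_cast (ne_of_gt ht)
    rw [Real.rpow_sub ht, Real.rpow_one]
    push_cast
    field_simp
  · intro t ht ψ
    have h4 : HasDerivAt (fun t : ℝ => ((t ^ β : ℝ) : ℂ)) ((β * t ^ (β - 1) : ℝ) : ℂ) t := by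
      exact (Real.hasDerivAt_rpow_const (p := β) (Or.inl (ne_of_gt ht))).ofReal_comp
    have h3 := ((h4.neg.mul_const (Complex.exp ((ψ:ℂ) * Complex.I))).cexp).const_mul (Complex.I / β)
    refine h3.congr_deriv ?_
    simp only [he, Pi.neg_apply]
    have hb : (β:ℂ) ≠ 0 := by exact_mod_cast hβ.ne'
    push_cast
    field_simp
  · intro ψ
    apply ContinuousAt.continuousWithinAt
    have : ContinuousAt (fun t : ℝ => ((t ^ β : ℝ) : ℂ)) 0 :=
      Complex.continuous_ofReal.continuousAt.comp
        (Real.continuousAt_rpow_const _ _ (Or.inr hβ.le))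
    exact ((this.neg.mul_const _).cexp).const_mul _
  · intro ψ hψ
    have hcp := lt_of_lt_of_le hc (hcos ψ hψ)
    have h0 : Tendsto (e ψ) atTop (𝓝 0) := by
      rw [tendsto_zero_iff_norm_tendsto_zero]
      simp only [hne]
      apply Real.tendsto_exp_atBot.comp
      exact (tendsto_rpow_atTop hβ).const_mul_atTop_of_neg (by linarith)
    simpa using h0.const_mul (Complex.I / β)
  · intro ψ hψ t ht
    have hts : 0 ≤ t ^ (β - 1) := Real.rpow_nonneg (le_of_lt ht) _
    have hts' : 0 ≤ t ^ β := Real.rpow_nonneg (le_of_lt ht) _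
    rw [norm_mul, norm_mul, hne, norm_mul, Complex.norm_exp_ofReal_mul_I, Complex.norm_real,
      Real.norm_of_nonneg hts]
    simp only [norm_neg, Complex.norm_I, mul_one]
    have := hcos ψ hψ
    gcongr
  · have h1 : Measurable (fun p : ℝ × ℝ => Complex.exp ((p.1:ℂ) * Complex.I)) := by
      apply Continuous.measurable; fun_prop
    exact hpm'.mul (((hpm.neg.mul h1).cexp).mul (h1.const_mul _))
  · intro t ht
    rw [he]; fun_prop

open Set Filter Topology in
lemma series_integral (β θ u φ : ℝ) (h0 : 0 < β) (h1 : β < 1) (hu : 0 < u) (hθ : 0 ≤ θ) (hθ' : θ < π / 2) :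
    HasSum (fun n : ℕ => (((-1) ^ n / (n.factorial : ℝ) *
        (Real.Gamma ((n:ℝ) * β + 1) * (1 / u) ^ ((n:ℝ) * β + 1)) : ℝ) : ℂ) *
          Complex.exp (((n:ℝ) * φ : ℝ) * Complex.I))
      (∫ t in Ioi (0:ℝ), Complex.exp (-(θ:ℂ) * Complex.I - u * t * Complex.exp (-(θ:ℂ) * Complex.I)) *
        Complex.exp (-((t ^ β : ℝ) : ℂ) * Complex.exp (((φ - θ * β : ℝ) : ℂ) * Complex.I))) := by
  have hc : 0 < Real.cos θ := Real.cos_pos_of_mem_Ioo ⟨by linarith [Real.pi_pos], hθ'⟩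
  set F : ℕ → ℝ → ℂ := fun n t => ((((-1) ^ n / (n.factorial : ℝ) : ℝ) : ℂ) *
     Complex.exp (((n:ℝ) * φ : ℝ) * Complex.I)) * (((t ^ ((n:ℝ) * β) : ℝ) : ℂ) *
      Complex.exp (-((θ * ((n:ℝ) * β + 1) : ℝ) : ℂ) * Complex.I
        - u * t * Complex.exp (-(θ:ℂ) * Complex.I))) with hF
  have hnF : ∀ n, ∀ t ∈ Ioi (0:ℝ), ‖F n t‖ = (1 / (n.factorial : ℝ)) *
      (t ^ ((n:ℝ) * β + 1 - 1) * Real.exp (-(u * Real.cos θ * t))) := by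
    intro n t ht
    simp only [hF, norm_mul, Complex.norm_exp_ofReal_mul_I, Complex.norm_real, mul_one, add_sub_cancel_right]
    rw [norm_div, norm_pow, Real.norm_of_nonneg (Real.rpow_nonneg (le_of_lt ht) _), Complex.norm_exp]
    simp [Complex.exp_re]
    left
    left
    ring
  have hii : ∀ n : ℕ, IntegrableOn (fun t : ℝ => t ^ ((n:ℝ) * β + 1 - 1) * Real.exp (-(u * Real.cos θ * t))) (Ioi 0) := by
    intro n
    have : -1 < (n:ℝ) * β + 1 - 1 := by
      have : 0 ≤ (n:ℝ) * β := by positivity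
      linarith
    simpa using integrableOn_rpow_mul_exp_neg_mul_rpow (p := 1) (b := u * Real.cos θ) this one_pos (by positivity)
  have hFi : ∀ n, Integrable (F n) (volume.restrict (Ioi 0)) := by
    intro n
    refine ((hii n).const_mul (1 / (n.factorial : ℝ))).mono' ?_ ?_
    · apply Measurable.aestronglyMeasurable
      have m1 : Measurable (fun t : ℝ => ((t ^ ((n:ℝ) * β) : ℝ) : ℂ)) :=
        Complex.measurable_ofReal.comp (measurable_id.pow_const _)
      have m2 : Measurable (fun t : ℝ => Complex.exp (-((θ * ((n:ℝ) * β + 1) : ℝ) : ℂ) * Complex.I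
        - u * t * Complex.exp (-(θ:ℂ) * Complex.I))) := by
        apply Continuous.measurable; fun_prop
      exact (m1.mul m2).const_mul _
    · rw [ae_restrict_iff' measurableSet_Ioi]
      exact ae_of_all _ fun t ht => (hnF n t ht).le
  have hsum : Summable fun n => ∫ t in Ioi (0:ℝ), ‖F n t‖ := by
    refine (gamma_summable β h0 h1 (1 / (u * Real.cos θ)) (by positivity)).congr ?_
    intro n
    rw [setIntegral_congr_fun measurableSet_Ioi (hnF n), integral_const_mul,
      Real.integral_rpow_mul_exp_neg_mul_Ioi (by positivity) (by positivity)]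
    ring
  have := hasSum_integral_of_summable_integral_norm hFi hsum
  convert! this using 1
  · ext n
    simp only [hF]
    rw [integral_const_mul, ray_integral _ u θ (by positivity) hu hθ hθ']
    push_cast
    ring
  · refine setIntegral_congr_fun measurableSet_Ioi fun t ht => ?_
    set z : ℂ := -((t ^ β : ℝ) : ℂ) * Complex.exp (((φ - θ * β : ℝ) : ℂ) * Complex.I) with hz
    have hs : HasSum (fun n : ℕ => z ^ n / (n.factorial : ℂ)) (Complex.exp z) := by
      rw [Complex.exp_eq_exp_ℂ]
      exact NormedSpace.expSeries_div_hasSum_exp z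
    rw [← (hs.mul_left (Complex.exp (-(θ:ℂ) * Complex.I - u * t * Complex.exp (-(θ:ℂ) * Complex.I)))).tsum_eq]
    congr 1
    ext n
    simp only [hF]
    rw [hz, mul_pow, neg_pow, ← Complex.exp_nat_mul, ← Complex.ofReal_pow, ← Real.rpow_natCast (t ^ β),
      ← Real.rpow_mul (le_of_lt ht), mul_comm β (n:ℝ)]
    have e1 : Complex.exp (((n:ℝ) * φ : ℝ) * Complex.I) *
        Complex.exp (-((θ * ((n:ℝ) * β + 1) : ℝ) : ℂ) * Complex.I
        - u * t * Complex.exp (-(θ:ℂ) * Complex.I)) =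
        Complex.exp (-(θ:ℂ) * Complex.I - u * t * Complex.exp (-(θ:ℂ) * Complex.I)) *
        Complex.exp ((n:ℂ) * (((φ - θ * β : ℝ) : ℂ) * Complex.I)) := by
      rw [← Complex.exp_add, ← Complex.exp_add]
      congr 1
      push_cast
      ring
    push_cast at e1 ⊢
    linear_combination (-1) * (((-1) ^ n / (n.factorial : ℂ)) * ((t ^ ((n:ℝ) * β) : ℝ) : ℂ)) * e1

open Set Filter Topology in
lemma eta_eq (α θ c u : ℝ) (h0 : 0 < α) (h1 : α < 2) (hu : 0 < u) (hθ : 0 ≤ θ) (hθ' : θ < π / 2)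
    (hc : 0 < c) (hca : c ≤ Real.cos (0 - θ * (α / 2)))
    (hcb : c ≤ Real.cos (π * (α / 2) - θ * (α / 2))) :
    eta α u = (-(1 / π)) * (∫ t in Ioi (0:ℝ),
      Complex.exp (-(θ:ℂ) * Complex.I - u * t * Complex.exp (-(θ:ℂ) * Complex.I)) *
        (Complex.exp (-((t ^ (α / 2) : ℝ) : ℂ) * Complex.exp (((π * (α / 2) - θ * (α / 2) : ℝ) : ℂ) * Complex.I))
        - Complex.exp (-((t ^ (α / 2) : ℝ) : ℂ) * Complex.exp (((0 - θ * (α / 2) : ℝ) : ℂ) * Complex.I)))).im := by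
  have hcθ : 0 < Real.cos θ := Real.cos_pos_of_mem_Ioo ⟨by linarith [Real.pi_pos], hθ'⟩
  have hint : ∀ x : ℝ, c ≤ Real.cos x → IntegrableOn (fun t : ℝ =>
      Complex.exp (-(θ:ℂ) * Complex.I - u * t * Complex.exp (-(θ:ℂ) * Complex.I)) *
        Complex.exp (-((t ^ (α / 2) : ℝ) : ℂ) * Complex.exp ((x : ℂ) * Complex.I))) (Ioi 0) := by
    intro x hx
    refine (integrableOn_exp_mul_Ioi (a := -(u * Real.cos θ)) (by nlinarith) 0).mono' ?_ ?_
    · apply Measurable.aestronglyMeasurable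
      have m1 : Measurable (fun t : ℝ => ((t ^ (α / 2) : ℝ) : ℂ)) :=
        Complex.measurable_ofReal.comp (measurable_id.pow_const _)
      have m2 : Measurable (fun t : ℝ => Complex.exp (-(θ:ℂ) * Complex.I
        - u * t * Complex.exp (-(θ:ℂ) * Complex.I))) := by
        apply Continuous.measurable; fun_prop
      exact m2.mul ((m1.neg.mul_const _).cexp)
    · rw [ae_restrict_iff' measurableSet_Ioi]
      refine ae_of_all _ fun t ht => ?_
      have hp : 0 ≤ t ^ (α / 2) := Real.rpow_nonneg (le_of_lt ht) _
      have e1 : ‖Complex.exp (-((t ^ (α / 2) : ℝ) : ℂ) * Complex.exp ((x : ℂ) * Complex.I))‖ ≤ 1 := by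
        rw [Complex.norm_exp, ← Complex.ofReal_neg, Complex.re_ofReal_mul, Complex.exp_ofReal_mul_I_re]
        apply Real.exp_le_one_iff.2
        nlinarith
      have e2 : ‖Complex.exp (-(θ:ℂ) * Complex.I - u * t * Complex.exp (-(θ:ℂ) * Complex.I))‖
          = Real.exp (-(u * Real.cos θ) * t) := by
        rw [Complex.norm_exp]
        congr 1
        simp [Complex.exp_re]
        ring
      rw [norm_mul, e2]
      exact mul_le_of_le_one_right (Real.exp_pos _).le e1
  have s1 := series_integral (α / 2) θ u (π * (α / 2)) (by linarith) (by linarith) hu hθ hθ'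
  have s0 := series_integral (α / 2) θ u 0 (by linarith) (by linarith) hu hθ hθ'
  have s := s1.sub s0
  rw [← integral_sub (hint _ hcb) (hint _ hca)] at s
  simp only [← mul_sub] at s
  have s2 := Complex.imCLM.hasSum s
  rw [← hasSum_nat_add_iff' 1] at s2
  simp only [Complex.imCLM_apply, Finset.range_one, Finset.sum_singleton] at s2
  have s3 := s2.neg.tsum_eq
  unfold eta
  have hterm : ∀ n, etaTerm α u n = -((((((-1) ^ (n + 1) / ((n + 1).factorial : ℝ) *
        (Real.Gamma (((n + 1 : ℕ):ℝ) * (α / 2) + 1) * (1 / u) ^ (((n + 1 : ℕ):ℝ) * (α / 2) + 1)) : ℝ) : ℂ) *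
          (Complex.exp ((((n + 1 : ℕ):ℝ) * (π * (α / 2)) : ℝ) * Complex.I)
          - Complex.exp ((((n + 1 : ℕ):ℝ) * 0 : ℝ) * Complex.I)))).im) := by
    intro n
    rw [Complex.im_ofReal_mul, Complex.sub_im, Complex.exp_ofReal_mul_I_im, Complex.exp_ofReal_mul_I_im,
      ← Real.Gamma_nat_eq_factorial]
    unfold etaTerm
    rw [Real.div_rpow zero_le_one hu.le, Real.one_rpow]
    push_cast
    rw [show ((n:ℝ) + 1) * (α / 2) + 1 = ((n:ℝ) + 1) * α / 2 + 1 by ring,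
      show 1 + ((n:ℝ) + 1) * α / 2 = ((n:ℝ) + 1) * α / 2 + 1 by ring,
      show ((n:ℝ) + 1) * (π * (α / 2)) = π * ((n:ℝ) + 1) * α / 2 by ring,
      show (n:ℝ) + 1 + 1 = n + 2 by ring]
    simp only [mul_zero, Real.sin_zero, sub_zero]
    have : Real.Gamma ((n:ℝ) + 2) ≠ 0 := (Real.Gamma_pos_of_pos (by positivity)).ne'
    have : u ^ (((n:ℝ) + 1) * α / 2 + 1) ≠ 0 := (Real.rpow_pos_of_pos hu _).ne'
    field_simp
    ring
  simp_rw [hterm]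
  rw [s3]
  simp

/-- For `α ∈ (0,2)`, the function `η₁^{(α/2)}` is Lebesgue integrable on `(0,∞)` with
integral `1`: it is a probability density on `(0,∞)`. -/
theorem stable_density_is_probability_density (α : ℝ) (hα : α ∈ Set.Ioo (0:ℝ) 2) :
    IntegrableOn (eta α) (Set.Ioi (0:ℝ))
      ∧ ∫ u in Set.Ioi (0:ℝ), eta α u = 1 := by
  obtain ⟨h0, h1⟩ := hα
  have hpi := Real.pi_pos
  set β := α / 2 with hβ
  have hβ0 : 0 < β := by rw [hβ]; linarith
  have hβ1 : β < 1 := by rw [hβ]; linarith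
  set θ := π * β / 2 with hθdef
  have hθ : 0 ≤ θ := by positivity
  have hθ' : θ < π / 2 := by rw [hθdef]; nlinarith
  set a := 0 - θ * β with ha
  set b := π * β - θ * β with hb
  have hθβ : 0 ≤ θ * β := by positivity
  have hab : a ≤ b := by rw [ha, hb]; nlinarith
  have hb2 : b < π / 2 := by
    rw [hb, hθdef]
    have : 0 < π * (1 - β) ^ 2 := by have : 0 < 1 - β := by linarith
                                     positivity
    nlinarith
  have hnab : -a ≤ b := by
    rw [ha, hb, hθdef]
    have : 0 ≤ π * (β * (1 - β)) := by have : 0 < 1 - β := by linarith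
                                       positivity
    nlinarith
  have hb0 : 0 ≤ b := by
    have : a ≤ 0 := by rw [ha]; linarith
    linarith
  set c := Real.cos b with hc
  have hc0 : 0 < c := Real.cos_pos_of_mem_Ioo ⟨by linarith, hb2⟩
  have hcos : ∀ ψ ∈ Set.Icc a b, c ≤ Real.cos ψ := by
    intro ψ hψ
    rw [← Real.cos_abs ψ]
    exact Real.cos_le_cos_of_nonneg_of_le_pi (abs_nonneg _) (by linarith)
      (abs_le.2 ⟨by linarith [hψ.1], hψ.2⟩)
  have hcθ : 0 < Real.cos θ := Real.cos_pos_of_mem_Ioo ⟨by linarith [Real.pi_pos], hθ'⟩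
  obtain ⟨fr1, fr2⟩ := frullani_rot β a b c hβ0 hab hc0 hcos
  set E : ℝ → ℝ → ℂ := fun u t =>
    Complex.exp (-(θ:ℂ) * Complex.I - u * t * Complex.exp (-(θ:ℂ) * Complex.I)) with hE
  set h : ℝ → ℂ := fun t => Complex.exp (-((t ^ β : ℝ) : ℂ) * Complex.exp ((b : ℂ) * Complex.I))
        - Complex.exp (-((t ^ β : ℝ) : ℂ) * Complex.exp ((a : ℂ) * Complex.I)) with hh
  have heta : ∀ u ∈ Set.Ioi (0:ℝ), eta α u = (-(1 / π)) * (∫ t in Set.Ioi (0:ℝ), E u t * h t).im :=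
    fun u hu => eta_eq α θ c u h0 h1 hu hθ hθ' hc0 (hcos a ⟨le_rfl, hab⟩) (hcos b ⟨hab, le_rfl⟩)
  have hEn : ∀ u t, ‖E u t‖ = Real.exp (-(t * Real.cos θ) * u) := by
    intro u t
    rw [hE]
    simp only [Complex.norm_exp]
    congr 1
    simp [Complex.exp_re]
    ring
  have hEc : Continuous (Function.uncurry E) := by
    rw [hE]; unfold Function.uncurry; fun_prop
  have hhm : Measurable h := by
    have m1 : Measurable (fun t : ℝ => ((t ^ β : ℝ) : ℂ)) :=
      Complex.measurable_ofReal.comp (measurable_id.pow_const _)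
    exact ((m1.neg.mul_const _).cexp).sub ((m1.neg.mul_const _).cexp)
  have hEi : ∀ t ∈ Set.Ioi (0:ℝ), IntegrableOn (fun u => E u t) (Set.Ioi 0) := by
    intro t ht
    have ht' : 0 < t := ht
    refine (integrableOn_exp_mul_Ioi (a := -(t * Real.cos θ)) (by nlinarith) 0).mono' ?_ ?_
    · exact (hEc.comp (Continuous.prodMk_left t)).aestronglyMeasurable
    · exact ae_of_all _ fun u => (hEn u t).le
  have hfr : ∀ t : ℝ, ((t⁻¹ : ℝ) : ℂ) * Complex.exp (-((t ^ β : ℝ) : ℂ) * Complex.exp ((b:ℂ) * Complex.I))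
        - ((t⁻¹ : ℝ) : ℂ) * Complex.exp (-((t ^ β : ℝ) : ℂ) * Complex.exp ((a:ℂ) * Complex.I))
        = ((t⁻¹ : ℝ) : ℂ) * h t := fun t => by rw [hh]; ring
  simp only [hfr] at fr1 fr2
  have hprod : Integrable (Function.uncurry fun u t => E u t * h t)
      ((volume.restrict (Set.Ioi (0:ℝ))).prod (volume.restrict (Set.Ioi (0:ℝ)))) := by
    rw [integrable_prod_iff']
    · constructor
      · rw [ae_restrict_iff' measurableSet_Ioi]
        exact ae_of_all _ fun t ht => (hEi t ht).mul_const (h t)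
      · have hb : IntegrableOn (fun t => (Real.cos θ)⁻¹ * ‖((t⁻¹ : ℝ) : ℂ) * h t‖) (Set.Ioi 0) := by
          refine (Integrable.norm ?_).const_mul _
          refine ((integrableOn_rpow_mul_exp_neg_mul_rpow (p := β) (s := β - 1) (b := c) (by linarith)
            hβ0 hc0).const_mul (b - a)).mono' ?_ ?_
          · exact ((Complex.measurable_ofReal.comp measurable_inv).mul hhm).aestronglyMeasurable
          · rw [ae_restrict_iff' measurableSet_Ioi]
            exact ae_of_all _ fun t ht => fr1 t ht
        refine IntegrableOn.congr_fun hb ?_ measurableSet_Ioi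
        intro t ht
        have ht' : 0 < t := ht
        simp only [Function.uncurry, norm_mul, hEn, Complex.norm_real]
        rw [integral_mul_const, integral_exp_mul_Ioi (by nlinarith), norm_inv, Real.norm_of_nonneg ht'.le]
        simp only [mul_zero, Real.exp_zero]
        field_simp
    · exact (hEc.measurable.mul (hhm.comp measurable_snd)).aestronglyMeasurable
  have hHi : IntegrableOn (fun u => ∫ t in Set.Ioi (0:ℝ), E u t * h t) (Set.Ioi 0) :=
    hprod.integral_prod_left
  have hval : ∫ u in Set.Ioi (0:ℝ), ∫ t in Set.Ioi (0:ℝ), E u t * h t = -(π : ℂ) * Complex.I := by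
    rw [integral_integral_swap hprod]
    have : ∀ t ∈ Set.Ioi (0:ℝ), ∫ u in Set.Ioi (0:ℝ), E u t * h t = ((t⁻¹ : ℝ) : ℂ) * h t := by
      intro t ht
      have ht' : 0 < t := ht
      rw [integral_mul_const]
      congr 1
      have e1 : ∀ u : ℝ, E u t = Complex.exp (-(θ:ℂ) * Complex.I) *
          Complex.exp (-(t * Complex.exp (-(θ:ℂ) * Complex.I)) * u) := by
        intro u
        rw [hE, ← Complex.exp_add]
        dsimp only
        congr 1
        ring
      simp only [e1]
      rw [integral_const_mul, integral_exp_mul_complex_Ioi]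
      · have : (t:ℂ) ≠ 0 := by exact_mod_cast ht'.ne'
        have := Complex.exp_ne_zero (-(θ:ℂ) * Complex.I)
        simp only [Complex.ofReal_zero, mul_zero, Complex.exp_zero]
        push_cast
        field_simp
      · simp [Complex.exp_re]
        positivity
    rw [setIntegral_congr_fun measurableSet_Ioi this, fr2]
    congr 3
    rw [ha, hb]
    field_simp
    ring
  constructor
  · refine IntegrableOn.congr_fun (hHi.im.const_mul (-(1 / π))) ?_ measurableSet_Ioi
    intro u hu
    exact (heta u hu).symm
  · rw [setIntegral_congr_fun measurableSet_Ioi heta, integral_const_mul]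
    have := integral_im hHi
    simp only [RCLike.im_to_complex] at this
    rw [this, hval]
    simp
end
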